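/- Let n ≥ 3 and c = 1, fix ω_0 ∈ S^{n−1} and δ > 0, and let f ∈ C_c^∞(ℝ^{1+n}; S^2) satisfy j_g f = 0, i.e. −f_{00} + Σ_{p=1}^{n} f_{pp} = 0. If L̃^{2,k} f((t,x), ω) = 0 for k = 0,1,2, all (t,x) ∈ ℝ^{1+n} and all ω ∈ B_n(ω_0, δ), then the Fourier transform of f vanishes on H_n: f̂_{ij}(ζ) = 0 for every ζ ∈ H_n and all i,j ∈ {0,…,n}. -/

import Mathlib

open MeasureTheory Finset

noncomputable section

/-- The light direction `ω̃ = (c, ω) ∈ ℝ^{1+n}`. -/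
def ld (n : ℕ) (c : ℝ) (ω : Fin n → ℝ) : Fin (n + 1) → ℝ := Fin.cons c ω

/-- The `k`-th momentum light ray transform of a rank-`m` symmetric tensor field,
`L^{m,k} f((t,x), ω) = Σ ω̃_{i_1}⋯ω̃_{i_m} ∫ s^k f_{i_1…i_m}((t,x) + s ω̃) ds`. -/
def mlrt (n m : ℕ) (c : ℝ) (k : ℕ)
    (f : (Fin m → Fin (n + 1)) → (Fin (n + 1) → ℝ) → ℂ)
    (x : Fin (n + 1) → ℝ) (ω : Fin n → ℝ) : ℂ :=
  ∑ i : Fin m → Fin (n + 1),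
    (∏ j, (ld n c ω (i j) : ℂ)) *
      ∫ s : ℝ, (s : ℂ) ^ k * f i (x + s • ld n c ω)

/-- A tensor field is symmetric: invariant under permutations of its indices. -/
def IsSymmF (n m : ℕ) (f : (Fin m → Fin (n + 1)) → (Fin (n + 1) → ℝ) → ℂ) : Prop :=
  ∀ (σ : Equiv.Perm (Fin m)) (i : Fin m → Fin (n + 1)), f (i ∘ σ) = f i

/-- All components are smooth and compactly supported. -/
def IsCc (n m : ℕ) (f : (Fin m → Fin (n + 1)) → (Fin (n + 1) → ℝ) → ℂ) : Prop :=
  ∀ i, ContDiff ℝ (⊤ : ℕ∞) (f i) ∧ HasCompactSupport (f i)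

/-- `ω ∈ S^{n-1}` (Euclidean unit sphere). -/
def onSphere (n : ℕ) (ω : Fin n → ℝ) : Prop := ∑ i, ω i ^ 2 = 1

/-- `ω ∈ B_n(ω₀, δ)`: on the sphere and at Euclidean distance `< δ` from `ω₀`. -/
def inBall (n : ℕ) (ω₀ : Fin n → ℝ) (δ : ℝ) (ω : Fin n → ℝ) : Prop :=
  onSphere n ω ∧ ∑ i, (ω i - ω₀ i) ^ 2 < δ ^ 2

/-- The `k`-th momentum light ray transform of a symmetric 2-tensor field (`c = 1`). -/
def lrt2 (n : ℕ) (k : ℕ) (f : Fin (n + 1) → Fin (n + 1) → (Fin (n + 1) → ℝ) → ℂ)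
    (x : Fin (n + 1) → ℝ) (ω : Fin n → ℝ) : ℂ :=
  ∑ i, ∑ j, (ld n 1 ω i : ℂ) * (ld n 1 ω j : ℂ) *
    ∫ s : ℝ, (s : ℂ) ^ k * f i j (x + s • ld n 1 ω)

/-- The Fourier transform on `ℝ^{1+n}`: `ĥ(ζ) = ∫ h(y) e^{−i y·ζ} dy`. -/
def ftrans (n : ℕ) (h : (Fin (n + 1) → ℝ) → ℂ) (ζ : Fin (n + 1) → ℝ) : ℂ :=
  ∫ y : Fin (n + 1) → ℝ, h y * Complex.exp (-Complex.I * ((∑ i, y i * ζ i : ℝ) : ℂ))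

/-- `ζ = (ζ₀, ζ') ∈ H_n`: `|ζ₀| < |ζ'|` and `ζ ⊥ (1, ω)` for some `ω ∈ B_n(ω₀, δ)`. -/
def memHn (n : ℕ) (ω₀ : Fin n → ℝ) (δ : ℝ) (ζ : Fin (n + 1) → ℝ) : Prop :=
  (ζ 0) ^ 2 < ∑ p : Fin n, (ζ p.succ) ^ 2 ∧
    ∃ ω : Fin n → ℝ, inBall n ω₀ δ ω ∧ ∑ i, ζ i * ld n 1 ω i = 0

open Filter Topology

lemma lim_zero (p : ℝ → ℂ) (hp : Continuous p) (C : ℝ) 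
    (hb : ∀ᶠ t : ℝ in 𝓝[≠] 0, ‖p t‖ ≤ C * |t|) : p 0 = 0 := by
  have h1 : Tendsto (fun t => ‖p t‖) (𝓝[≠] (0:ℝ)) (𝓝 ‖p 0‖) :=
    (hp.norm.tendsto 0).mono_left nhdsWithin_le_nhds
  have h2 : Tendsto (fun t : ℝ => C * |t|) (𝓝[≠] (0:ℝ)) (𝓝 (C * |(0:ℝ)|)) :=
    ((continuous_const.mul continuous_abs).tendsto 0).mono_left nhdsWithin_le_nhds
  have := le_of_tendsto_of_tendsto h1 h2 hb
  simpa using this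

lemma poly_zero (a b c d e : ℂ) (C : ℝ)
    (hb : ∀ᶠ t : ℝ in 𝓝 0, ‖a + b * t + c * t ^ 2 + d * t ^ 3 + e * t ^ 4‖ ≤ C * |t| ^ 3) :
    a = 0 ∧ b = 0 ∧ c = 0 := by
  have ha : a = 0 := by
    have := hb.self_of_nhds
    simpa using this
  subst ha
  have hb' : ∀ᶠ t : ℝ in 𝓝[≠] 0, ‖b + c * t + d * t ^ 2 + e * t ^ 3‖ ≤ C * |t| ^ 2 := by
    filter_upwards [hb.filter_mono nhdsWithin_le_nhds, self_mem_nhdsWithin] with t ht h0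
    have h0 : (0:ℝ) < |t| := abs_pos.mpr h0
    have e1 : (0 + b * t + c * t ^ 2 + d * t ^ 3 + e * t ^ 4 : ℂ)
      = t * (b + c * t + d * t ^ 2 + e * t ^ 3) := by ring
    rw [e1, norm_mul, Complex.norm_real, Real.norm_eq_abs] at ht
    refine le_of_mul_le_mul_left ?_ h0
    calc _ ≤ _ := ht
      _ = _ := by ring
  have hb0 : b = 0 := by
    have := lim_zero (fun t : ℝ => b + c * t + d * t ^ 2 + e * t ^ 3) (by fun_prop) |C| (by
      have h1 : ∀ᶠ t : ℝ in 𝓝[≠] 0, |t| < 1 := by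
        refine Filter.Eventually.filter_mono nhdsWithin_le_nhds ?_
        exact (continuous_abs.tendsto (0:ℝ)).eventually_lt_const (by simp)
      filter_upwards [hb', h1] with t ht h1
      refine ht.trans ?_
      have : |t|^2 ≤ |t| := by nlinarith [abs_nonneg t]
      calc C * |t|^2 ≤ |C| * |t|^2 := by gcongr; exact le_abs_self C
        _ ≤ _ := by gcongr)
    simpa using this
  subst hb0
  refine ⟨rfl, rfl, ?_⟩
  have := lim_zero (fun t : ℝ => c + d * t + e * t ^ 2) (by fun_prop) C (by
      filter_upwards [hb', self_mem_nhdsWithin] with t ht h0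
      have h0 : (0:ℝ) < |t| := abs_pos.mpr h0
      have e1 : (0 + c * t + d * t ^ 2 + e * t ^ 3 : ℂ)
        = t * (c + d * t + e * t ^ 2) := by ring
      rw [e1, norm_mul, Complex.norm_real, Real.norm_eq_abs] at ht
      refine le_of_mul_le_mul_left ?_ h0
      calc _ ≤ _ := ht
        _ = _ := by ring)
  simpa using this

/-- Spatial vector. -/
def sp (n : ℕ) : (Fin n → ℝ) →ₗ[ℝ] (Fin (n + 1) → ℝ) where
  toFun a := Fin.cons 0 a
  map_add' a b := by ext i; refine Fin.cases ?_ (fun p => ?_) i <;> simp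
  map_smul' a b := by ext i; refine Fin.cases ?_ (fun p => ?_) i <;> simp

lemma ld_eq (n : ℕ) (ω : Fin n → ℝ) : ld n 1 ω = Pi.single 0 1 + sp n ω := by
  ext i; refine Fin.cases ?_ (fun p => ?_) i <;> simp [ld, sp]

lemma curve_eq (n : ℕ) (ω η : Fin n → ℝ) (r t : ℝ) (h : 1 + r * t ^ 2 ≠ 0) :
    (1 + r * t ^ 2) • ld n 1 ((1 + r * t ^ 2)⁻¹ • ((1 - r * t ^ 2) • ω + (2 * t) • η)) =
    ld n 1 ω + t • ((2:ℝ) • sp n η) + (t ^ 2) • (r • (Pi.single 0 1 - sp n ω)) := by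
  rw [ld_eq, ld_eq, smul_add, ← map_smul, smul_smul, mul_inv_cancel₀ h, one_smul]
  ext i; refine Fin.cases ?_ (fun p => ?_) i 
  · simp [sp]; ring
  · simp [sp]; ring

/-- One-point information. -/
lemma onept (n : ℕ) (ω₀ : Fin n → ℝ) (δ : ℝ) (ζ : Fin (n + 1) → ℝ)
    (B : (Fin (n + 1) → ℝ) →ₗ[ℝ] (Fin (n + 1) → ℝ) →ₗ[ℝ] ℂ)
    (hB : ∀ x y, B x y = B y x) (C : ℝ) 
    (h : ∀ ω, inBall n ω₀ δ ω → |ζ ⬝ᵥ ld n 1 ω| ≤ 1 →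
      ‖B (ld n 1 ω) (ld n 1 ω)‖ ≤ C * |ζ ⬝ᵥ ld n 1 ω| ^ 3)
    (ω : Fin n → ℝ) (hω : inBall n ω₀ δ ω) (hζ : ζ ⬝ᵥ ld n 1 ω = 0)
    (η : Fin n → ℝ) (hη : ω ⬝ᵥ η = 0) :
    B (ld n 1 ω) (ld n 1 ω) = 0 ∧ B (ld n 1 ω) (sp n η) = 0 ∧
    2 * B (sp n η) (sp n η) + (η ⬝ᵥ η : ℝ) * B (ld n 1 ω) (Pi.single 0 1 - sp n ω) = 0 := by
  have hC : 0 ≤ |C| := abs_nonneg C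
  set r := η ⬝ᵥ η with hr
  have hr0 : 0 ≤ r := by
    rw [hr]; exact Finset.sum_nonneg fun i _ => mul_self_nonneg _
  set X := ld n 1 ω with hX
  set Y := sp n η with hY
  set Z : Fin (n+1) → ℝ := Pi.single 0 1 - sp n ω with hZ
  have hpos : ∀ t : ℝ, 0 < 1 + r * t ^ 2 := fun t => by positivity
  have hge : ∀ t : ℝ, 1 ≤ 1 + r * t ^ 2 := fun t => by
    have : 0 ≤ r * t^2 := by positivity
    linarith
  let w : ℝ → Fin n → ℝ := fun t => (1 + r * t ^ 2)⁻¹ • ((1 - r * t ^ 2) • ω + (2 * t) • η)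
  have hwc : Continuous w := by
    refine Continuous.smul (Continuous.inv₀ (by fun_prop) fun t => (hpos t).ne') (by fun_prop)
  have hw0 : w 0 = ω := by simp [w]
  have hsph : ∀ t, onSphere n (w t) := by
    intro t
    have h1 : ω ⬝ᵥ ω = 1 := by
      have := hω.1
      unfold onSphere at this
      simpa [dotProduct, sq] using this
    have h2 : w t ⬝ᵥ w t = 1 := by
      simp only [w, smul_dotProduct, dotProduct_smul, add_dotProduct, dotProduct_add, h1,
        dotProduct_comm η ω, hη, ← hr, smul_eq_mul]
      have := (hpos t).ne'
      field_simp
      ring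
    unfold onSphere
    simpa [dotProduct, sq] using h2
  have hball : ∀ᶠ t in 𝓝 (0:ℝ), inBall n ω₀ δ (w t) := by
    have hc : Continuous fun t => ∑ i, (w t i - ω₀ i) ^ 2 := by
      refine continuous_finsetSum _ fun i _ => ?_
      have := (continuous_apply i).comp hwc
      exact (this.sub continuous_const).pow 2
    have := (hc.tendsto 0).eventually_lt_const (u := δ^2) (by simpa [hw0] using hω.2)
    filter_upwards [this] with t ht using ⟨hsph t, ht⟩
  have hcurve : ∀ t, (1 + r * t ^ 2) • ld n 1 (w t) =
      X + t • ((2:ℝ) • Y) + (t ^ 2) • (r • Z) := fun t =>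
    curve_eq n ω η r t (hpos t).ne'
  let q : ℝ → ℝ := fun t => 2 * (ζ ⬝ᵥ Y) + t * (r * (ζ ⬝ᵥ Z))
  have hdot : ∀ t, (1 + r * t ^ 2) * (ζ ⬝ᵥ ld n 1 (w t)) = t * q t := by
    intro t
    have := congrArg (fun v => ζ ⬝ᵥ v) (hcurve t)
    simp only [dotProduct_smul, dotProduct_add, hζ, smul_eq_mul] at this
    rw [this]; simp only [q]; ring
  have hqc : Continuous q := by fun_prop
  have habs : ∀ t, |ζ ⬝ᵥ ld n 1 (w t)| ≤ |t| * |q t| := by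
    intro t
    rw [← abs_mul, ← hdot, abs_mul, abs_of_pos (hpos t)]
    nlinarith [hge t, abs_nonneg (ζ ⬝ᵥ ld n 1 (w t))]
  have hsmall : ∀ᶠ t in 𝓝 (0:ℝ), |t| * |q t| < 1 :=
    ((continuous_abs.mul hqc.abs).tendsto 0).eventually_lt_const (by simp)
  have hqb : ∀ᶠ t in 𝓝 (0:ℝ), |q t| < |q 0| + 1 :=
    (hqc.abs.tendsto 0).eventually_lt_const (by simp)
  have hrb : ∀ᶠ t in 𝓝 (0:ℝ), (1 + r * t ^ 2)^2 < 2 := by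
    have : Continuous fun t : ℝ => (1 + r * t ^ 2)^2 := by fun_prop
    exact (this.tendsto 0).eventually_lt_const (by simp)
  have key := poly_zero (B X X) (4 * B X Y) (4 * B Y Y + 2 * r * B X Z)
    (4 * r * B Y Z) (r ^ 2 * B Z Z) (2 * |C| * (|q 0| + 1)^3) (by
      filter_upwards [hball, hsmall, hqb, hrb] with t h1 h2 h3 h4
      have e1 : B ((1 + r * t ^ 2) • ld n 1 (w t)) ((1 + r * t ^ 2) • ld n 1 (w t)) =
        B X X + 4 * B X Y * t + (4 * B Y Y + 2 * r * B X Z) * t ^ 2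
          + 4 * r * B Y Z * t ^ 3 + r ^ 2 * B Z Z * t ^ 4 := by
        rw [hcurve]
        simp only [map_add, map_smul, LinearMap.add_apply, LinearMap.smul_apply,
          Complex.real_smul, hB Y X, hB Z X, hB Z Y]
        push_cast
        ring
      rw [← e1]
      simp only [map_smul, LinearMap.smul_apply, norm_smul, Real.norm_eq_abs, abs_of_pos (hpos t)]
      have h5 := h _ h1 ((habs t).trans h2.le)
      have h6 : ‖B (ld n 1 (w t)) (ld n 1 (w t))‖ ≤ |C| * (|t| * (|q 0| + 1))^3 := by
        refine h5.trans ?_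
        calc C * |ζ ⬝ᵥ ld n 1 (w t)| ^ 3 ≤ |C| * |ζ ⬝ᵥ ld n 1 (w t)| ^ 3 := by
              gcongr; exact le_abs_self C
          _ ≤ |C| * (|t| * (|q 0| + 1)) ^ 3 := by
              gcongr
              refine (habs t).trans ?_
              gcongr
      calc _ = (1 + r * t^2)^2 * ‖B (ld n 1 (w t)) (ld n 1 (w t))‖ := by ring
        _ ≤ 2 * (|C| * (|t| * (|q 0| + 1))^3) := by gcongr
        _ = _ := by ring)
  obtain ⟨k1, k2, k3⟩ := key
  refine ⟨k1, by simpa using k2, ?_⟩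
  linear_combination k3 / 2

/-- `sp η` component. -/
lemma sp_decomp (n : ℕ) (ω a : Fin n → ℝ) (h : ω ⬝ᵥ ω = 1) :
    ∃ η, ω ⬝ᵥ η = 0 ∧ a = (ω ⬝ᵥ a) • ω + η :=
  ⟨a - (ω ⬝ᵥ a) • ω, by simp [dotProduct_sub, h], by simp⟩

lemma vec_decomp (n : ℕ) (x : Fin (n + 1) → ℝ) :
    x = x 0 • (Pi.single 0 1 : Fin (n + 1) → ℝ) + sp n (fun p => x p.succ) := by
  ext i; refine Fin.cases ?_ (fun p => ?_) i <;> simp [sp]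

lemma trace_step (n : ℕ) 
    (B : (Fin (n + 1) → ℝ) →ₗ[ℝ] (Fin (n + 1) → ℝ) →ₗ[ℝ] ℂ)
    (hB : ∀ x y, B x y = B y x) 
    (htr : B (Pi.single 0 1) (Pi.single 0 1) =
      ∑ p : Fin n, B (sp n (Pi.single p 1)) (sp n (Pi.single p 1)))
    (ω : Fin n → ℝ) (hω : ω ⬝ᵥ ω = 1)
    (h0 : B (ld n 1 ω) (ld n 1 ω) = 0)
    (h1 : ∀ η, ω ⬝ᵥ η = 0 → B (ld n 1 ω) (sp n η) = 0)
    (h2 : ∀ η, ω ⬝ᵥ η = 0 → 2 * B (sp n η) (sp n η) +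
      (η ⬝ᵥ η : ℝ) * B (ld n 1 ω) (Pi.single 0 1 - sp n ω) = 0) :
    (∀ x, B (ld n 1 ω) x = 0) ∧
    ∀ η, ω ⬝ᵥ η = 0 → B (sp n η) (sp n η) = 0 := by
  set E : Fin (n + 1) → ℝ := Pi.single 0 1 with hE
  set W := sp n ω with hW
  set κ := B (ld n 1 ω) (E - W) with hκ
  have hκ' : κ = B E E - B W W := by
    rw [hκ, ld_eq]
    simp only [map_add, map_sub, LinearMap.add_apply, hB W E, ← hE, ← hW]
    ring
  have hp : ∀ p : Fin n, 2 * B (sp n (Pi.single p 1)) (sp n (Pi.single p 1)) =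
      -((1 - ω p ^ 2 : ℝ) * κ) + 4 * (B (sp n ((ω p) • Pi.single p 1)) W - (ω p ^ 2 : ℝ) * B W W)
        + 2 * (ω p ^ 2 : ℝ) * B W W := by
    intro p
    have a1 : ω ⬝ᵥ (Pi.single p 1 - (ω p) • ω) = 0 := by
      simp [dotProduct_sub, hω]
    have a2 := h2 _ a1
    have a3 : (Pi.single p 1 - (ω p) • ω) ⬝ᵥ (Pi.single p 1 - (ω p) • ω) = 1 - ω p ^ 2 := by
      simp [dotProduct_sub, sub_dotProduct, hω]; ring
    rw [a3] at a2
    simp only [map_sub, map_smul, LinearMap.sub_apply, LinearMap.smul_apply, ← hW,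
      Complex.real_smul, hB W (sp n (Pi.single p 1))] at a2 ⊢
    push_cast at a2 ⊢
    linear_combination a2
  have hsum : ∑ p, ω p ^ 2 = 1 := by simpa [dotProduct, sq] using hω
  have hvec : ∑ p, (ω p) • (Pi.single p 1 : Fin n → ℝ) = ω := by
    ext q; simp [Finset.sum_apply, Pi.single_apply]
  have hS : ∑ p : Fin n, 2 * B (sp n (Pi.single p 1)) (sp n (Pi.single p 1)) =
      -((n - 1 : ℝ) * κ) + 4 * (B W W - B W W) + 2 * B W W := by
    rw [Finset.sum_congr rfl fun p _ => hp p, Finset.sum_add_distrib, Finset.sum_add_distrib,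
      Finset.sum_neg_distrib, ← Finset.sum_mul, ← Finset.sum_mul, ← Finset.mul_sum,
      ← Finset.mul_sum, Finset.sum_sub_distrib, ← Finset.sum_mul]
    have c1 : ∑ p : Fin n, B (sp n ((ω p) • Pi.single p 1)) W = B W W := by
      rw [← LinearMap.sum_apply, ← map_sum, ← map_sum, hvec]
    have c2 : ∑ p : Fin n, ((ω p ^ 2 : ℝ) : ℂ) = 1 := by
      rw [← Complex.ofReal_sum, hsum]; simp
    have c3 : ∑ p : Fin n, ((1 - ω p ^ 2 : ℝ) : ℂ) = ((n - 1 : ℝ) : ℂ) := by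
      rw [← Complex.ofReal_sum, Finset.sum_sub_distrib, hsum]; simp
    rw [c1, c2, c3]; ring
  rw [← Finset.mul_sum, ← htr] at hS
  have hk0 : κ = 0 := by
    have : ((n + 1 : ℝ) : ℂ) * κ = 0 := by
      push_cast at hS ⊢
      linear_combination 2 * hκ' + hS
    rcases mul_eq_zero.mp this with h | h
    · exfalso
      have : (n + 1 : ℝ) = 0 := by exact_mod_cast h
      have h' : (0:ℝ) < n + 1 := by positivity
      linarith
    · exact h
  rw [hk0] at h2
  have hl : B (ld n 1 ω) (E + W) = 0 := by rw [← ld_eq]; exact h0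
  have hm : B (ld n 1 ω) (E - W) = 0 := hk0
  rw [map_add] at hl
  rw [map_sub] at hm
  have hE0 : B (ld n 1 ω) E = 0 := by linear_combination (hl + hm) / 2
  have hW0 : B (ld n 1 ω) W = 0 := by linear_combination (hl - hm) / 2
  constructor
  · intro x
    obtain ⟨η, e1, e2⟩ := sp_decomp n ω (fun p => x p.succ) hω
    rw [vec_decomp n x, e2]
    simp [← hE, ← hW, hE0, hW0, h1 η e1]
  · intro η hη
    simpa using h2 η hη

lemma twopt (n : ℕ) 
    (B : (Fin (n + 1) → ℝ) →ₗ[ℝ] (Fin (n + 1) → ℝ) →ₗ[ℝ] ℂ)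
    (hB : ∀ x y, B x y = B y x) 
    (ω ω' : Fin n → ℝ) (hne : ω ⬝ᵥ (ω' - ω) ≠ 0)
    (h1 : ∀ x, B (ld n 1 ω) x = 0) (h1' : ∀ x, B (ld n 1 ω') x = 0)
    (h2 : ∀ η, ω ⬝ᵥ η = 0 → B (sp n η) (sp n η) = 0) : ∀ x y, B x y = 0 := by
  set σ := ω' - ω with hσ
  have hs : ∀ x, B (sp n σ) x = 0 := by
    intro x
    have := h1 x
    have h3 := h1' x
    rw [ld_eq] at this h3
    rw [hσ, map_sub, map_sub, LinearMap.sub_apply]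
    rw [map_add, LinearMap.add_apply] at this h3
    linear_combination h3 - this
  have hpol : ∀ a b, ω ⬝ᵥ a = 0 → ω ⬝ᵥ b = 0 → B (sp n a) (sp n b) = 0 := by
    intro a b ha hb
    have := h2 (a + b) (by simp [dotProduct_add, ha, hb])
    simp only [map_add, LinearMap.add_apply, h2 a ha, h2 b hb, hB (sp n b) (sp n a)] at this
    linear_combination this / 2
  have hdec : ∀ a, ∃ c : ℝ, ∃ η, ω ⬝ᵥ η = 0 ∧ a = c • σ + η := by
    intro a
    refine ⟨(ω ⬝ᵥ a) / (ω ⬝ᵥ σ), a - ((ω ⬝ᵥ a) / (ω ⬝ᵥ σ)) • σ, ?_, by simp⟩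
    rw [dotProduct_sub, dotProduct_smul, smul_eq_mul, div_mul_cancel₀ _ hne, sub_self]
  have hN : ∀ a b, B (sp n a) (sp n b) = 0 := by
    intro a b
    obtain ⟨c, η, e1, rfl⟩ := hdec a
    obtain ⟨d, η', e2, rfl⟩ := hdec b
    simp [hs, hB _ (sp n σ), hpol η η' e1 e2]
  have hE1 : ∀ x, B (Pi.single 0 1) x = - B (sp n ω) x := by
    intro x
    have := h1 x
    rw [ld_eq, map_add, LinearMap.add_apply] at this
    linear_combination this
  have hSp : ∀ a x, B (sp n a) x = 0 := by
    intro a x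
    rw [vec_decomp n x, map_add, map_smul, hN, hB, hE1, hN]
    simp
  intro x y
  rw [vec_decomp n x, map_add, map_smul, LinearMap.add_apply, hSp, LinearMap.smul_apply, hE1, hSp]
  simp

lemma second_pt (n : ℕ) (hn : 3 ≤ n) (ω₀ : Fin n → ℝ) (δ : ℝ) (z ω : Fin n → ℝ)
    (hω : inBall n ω₀ δ ω) (hz : (z ⬝ᵥ ω) ^ 2 < z ⬝ᵥ z) :
    ∃ ω', inBall n ω₀ δ ω' ∧ z ⬝ᵥ ω' = z ⬝ᵥ ω ∧ ω ⬝ᵥ (ω' - ω) ≠ 0 := by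
  have h1 : ω ⬝ᵥ ω = 1 := by
    have := hω.1
    unfold onSphere at this
    simpa [dotProduct, sq] using this
  obtain ⟨e, he0, hez, heω⟩ : ∃ e : Fin n → ℝ, e ≠ 0 ∧ z ⬝ᵥ e = 0 ∧ ω ⬝ᵥ e = 0 := by
    let T : (Fin n → ℝ) →ₗ[ℝ] (Fin 2 → ℝ) := Matrix.mulVecLin (Matrix.of ![z, ω])
    have hk : LinearMap.ker T ≠ ⊥ := LinearMap.ker_ne_bot_of_finrank_lt (by simp; omega)
    obtain ⟨e, he, he0⟩ := (Submodule.ne_bot_iff _).mp hk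
    have h3 : T e = 0 := he
    refine ⟨e, he0, ?_, ?_⟩
    · simpa [T, Matrix.mulVec] using congrFun h3 0
    · simpa [T, Matrix.mulVec] using congrFun h3 1
  have hzz : 0 < z ⬝ᵥ z := lt_of_le_of_lt (sq_nonneg _) hz
  set w := ω - ((z ⬝ᵥ ω) / (z ⬝ᵥ z)) • z with hw
  have hzw : z ⬝ᵥ w = 0 := by
    rw [hw, dotProduct_sub, dotProduct_smul, smul_eq_mul, div_mul_cancel₀ _ hzz.ne', sub_self]
  have hωw : ω ⬝ᵥ w = 1 - (z ⬝ᵥ ω)^2 / (z ⬝ᵥ z) := by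
    rw [hw, dotProduct_sub, dotProduct_smul, smul_eq_mul, h1, dotProduct_comm ω z]; ring
  have hρ : 0 < ω ⬝ᵥ w := by
    rw [hωw, sub_pos, div_lt_one hzz]; exact hz
  have hww : w ⬝ᵥ w = ω ⬝ᵥ w := by
    nth_rw 1 [hw]
    rw [sub_dotProduct, smul_dotProduct, hzw]; simp
  have hwe : w ⬝ᵥ e = 0 := by
    rw [hw, sub_dotProduct, smul_dotProduct, hez, heω]; simp
  have hee : 0 < e ⬝ᵥ e := by
    have h0 : 0 ≤ e ⬝ᵥ e := Finset.sum_nonneg fun i _ => mul_self_nonneg _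
    exact lt_of_le_of_ne h0 fun h => he0 (dotProduct_self_eq_zero.mp h.symm)
  set m := Real.sqrt ((ω ⬝ᵥ w) / (e ⬝ᵥ e)) with hm
  have hm2 : m ^ 2 * (e ⬝ᵥ e) = ω ⬝ᵥ w := by
    rw [hm, Real.sq_sqrt (by positivity)]; field_simp
  let v : ℝ → Fin n → ℝ := fun t => ω + (Real.cos t - 1) • w + (Real.sin t * m) • e
  have hvc : Continuous v := by fun_prop
  have hv0 : v 0 = ω := by simp [v]
  have hev : ∀ᶠ t in 𝓝 (0:ℝ), ∑ i, (v t i - ω₀ i) ^ 2 < δ ^ 2 := by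
    have hc : Continuous fun t => ∑ i, (v t i - ω₀ i) ^ 2 := by
      refine continuous_finsetSum _ fun i _ => ?_
      have := (continuous_apply i).comp hvc
      exact (this.sub continuous_const).pow 2
    exact (hc.tendsto 0).eventually_lt_const (by simpa [hv0] using hω.2)
  have hpi : ∀ᶠ t in 𝓝 (0:ℝ), t < Real.pi := eventually_lt_nhds Real.pi_pos
  obtain ⟨t, ⟨ht1, ht2⟩, ht3⟩ := 
    (((hev.and hpi).filter_mono (nhdsWithin_le_nhds (s := Set.Ioi 0))).and
      (self_mem_nhdsWithin (a := (0:ℝ)) (s := Set.Ioi 0))).exists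
  have ht3 : 0 < t := ht3
  have hcos : Real.cos t < 1 := by
    have := Real.cos_lt_cos_of_nonneg_of_le_pi le_rfl ht2.le ht3
    simpa using this
  refine ⟨v t, ⟨?_, ht1⟩, ?_, ?_⟩
  · have : v t ⬝ᵥ v t = 1 := by
      simp only [v, add_dotProduct, dotProduct_add, smul_dotProduct, dotProduct_smul, smul_eq_mul,
        h1, heω, hwe, hww, dotProduct_comm w ω, dotProduct_comm e ω, dotProduct_comm e w]
      linear_combination (Real.sin t)^2 * hm2 + (ω ⬝ᵥ w) * Real.sin_sq_add_cos_sq t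
    unfold onSphere
    simpa [dotProduct, sq] using this
  · simp [v, dotProduct_add, hzw, hez]
  · have : ω ⬝ᵥ (v t - ω) = (Real.cos t - 1) * (ω ⬝ᵥ w) := by
      simp [v, dotProduct_sub, dotProduct_add, heω]
    rw [this]
    exact mul_ne_zero (by linarith) hρ.ne'

lemma fubini_line (n : ℕ) (ω : Fin n → ℝ) (g : (Fin (n + 1) → ℝ) → ℂ) (hg : Continuous g)
    (hc : HasCompactSupport g)
    (h0 : ∀ x : Fin n → ℝ, ∫ s : ℝ, g (sp n x + s • ld n 1 ω) = 0) : ∫ y, g y = 0 := by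
  have hem := (volume_preserving_piFinSuccAbove (fun _ : Fin (n + 1) => ℝ) 0).symm
  have hmap : ∀ (t : ℝ) (x : Fin n → ℝ),
      (MeasurableEquiv.piFinSuccAbove (fun _ : Fin (n + 1) => ℝ) 0).symm (t, x)
        = Fin.cons t x := by
    intro t x
    simp [MeasurableEquiv.piFinSuccAbove]
    rfl
  have hcons : Continuous fun p : ℝ × (Fin n → ℝ) => (Fin.cons p.1 p.2 : Fin (n + 1) → ℝ) := by
    refine continuous_pi fun i => ?_
    refine Fin.cases ?_ (fun p => ?_) i <;> simp <;> fun_prop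
  have hce : Topology.IsClosedEmbedding
      fun p : ℝ × (Fin n → ℝ) => (Fin.cons p.1 p.2 : Fin (n + 1) → ℝ) :=
    Function.LeftInverse.isClosedEmbedding (f := fun y => (y 0, fun p => y p.succ))
      (fun p => by simp) (by fun_prop) hcons
  have hse : Topology.IsClosedEmbedding
      fun p : ℝ × (Fin n → ℝ) => (sp n p.2 + p.1 • ld n 1 ω : Fin (n + 1) → ℝ) := by
    refine Function.LeftInverse.isClosedEmbedding
      (f := fun y => (y 0, fun p => y p.succ - y 0 * ω p))
      (fun p => by simp [sp, ld]) (by fun_prop) ?_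
    have : Continuous (sp n) := (sp n).continuous_of_finiteDimensional
    fun_prop
  rw [← hem.integral_comp (MeasurableEquiv.measurableEmbedding _)]
  have e1 : (fun p : ℝ × (Fin n → ℝ) =>
      g ((MeasurableEquiv.piFinSuccAbove (fun _ : Fin (n + 1) => ℝ) 0).symm p))
      = g ∘ fun p => Fin.cons p.1 p.2 := by
    ext ⟨t, x⟩; rw [hmap]; rfl
  have hint : Integrable (g ∘ fun p : ℝ × (Fin n → ℝ) => (Fin.cons p.1 p.2 : Fin (n + 1) → ℝ)) :=
    (hg.comp hcons).integrable_of_hasCompactSupport (hc.comp_isClosedEmbedding hce)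
  rw [e1, Measure.volume_eq_prod, integral_prod _ hint]
  have e2 : ∀ t : ℝ, ∫ x : Fin n → ℝ, (g ∘ fun p : ℝ × (Fin n → ℝ) =>
      (Fin.cons p.1 p.2 : Fin (n + 1) → ℝ)) (t, x) =
      ∫ x : Fin n → ℝ, g (sp n x + t • ld n 1 ω) := by
    intro t
    rw [← integral_add_right_eq_self _ (t • ω)]
    congr 1
    ext x
    simp only [Function.comp]
    congr 1
    ext i; refine Fin.cases ?_ (fun p => ?_) i <;> simp [sp, ld]
  simp only [e2]
  rw [integral_integral_swap_of_hasCompactSupport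
    (f := fun (t : ℝ) (x : Fin n → ℝ) => g (sp n x + t • ld n 1 ω))
    (hg.comp hse.continuous) (hc.comp_isClosedEmbedding hse)]
  simp [h0]

lemma line_emb (n : ℕ) (ω : Fin n → ℝ) (x : Fin (n + 1) → ℝ) :
    Topology.IsClosedEmbedding fun s : ℝ => x + s • ld n 1 ω :=
  Function.LeftInverse.isClosedEmbedding (f := fun y => y 0 - x 0)
      (fun p => by simp [ld]) (by fun_prop) (by fun_prop)

/-- contraction -/
def contr (n : ℕ) (f : Fin (n + 1) → Fin (n + 1) → (Fin (n + 1) → ℝ) → ℂ)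
    (ω : Fin n → ℝ) (y : Fin (n + 1) → ℝ) : ℂ :=
  ∑ i, ∑ j, (ld n 1 ω i : ℂ) * (ld n 1 ω j : ℂ) * f i j y

lemma ld_abs_le (n : ℕ) (ω : Fin n → ℝ) (h : onSphere n ω) (i) : |ld n 1 ω i| ≤ 1 := by
  refine Fin.cases ?_ (fun p => ?_) i
  · simp [ld]
  · simp only [ld, Fin.cons_succ]
    rw [← sq_le_one_iff_abs_le_one, ← h]
    exact Finset.single_le_sum (f := fun i => ω i ^ 2) (fun i _ => sq_nonneg _) (Finset.mem_univ p)

lemma contr_le (n : ℕ) (f : Fin (n + 1) → Fin (n + 1) → (Fin (n + 1) → ℝ) → ℂ)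
    (ω : Fin n → ℝ) (h : onSphere n ω) (y : Fin (n + 1) → ℝ) :
    ‖contr n f ω y‖ ≤ ∑ i, ∑ j, ‖f i j y‖ := by
  refine norm_sum_le_of_le _ fun i _ => norm_sum_le_of_le _ fun j _ => ?_
  rw [norm_mul, norm_mul, Complex.norm_real, Complex.norm_real]
  have h1 := ld_abs_le n ω h i
  have h2 := ld_abs_le n ω h j
  have : |ld n 1 ω i| * |ld n 1 ω j| ≤ 1 := mul_le_one₀ h1 (abs_nonneg _) h2
  exact mul_le_of_le_one_left (norm_nonneg _) this

lemma fourier_bound (n : ℕ) (ω₀ : Fin n → ℝ) (δ : ℝ) 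
    (f : Fin (n + 1) → Fin (n + 1) → (Fin (n + 1) → ℝ) → ℂ)
    (hreg : ∀ i j, ContDiff ℝ (⊤ : ℕ∞) (f i j) ∧ HasCompactSupport (f i j))
    (h : ∀ k ≤ 2, ∀ (x : Fin (n + 1) → ℝ) (ω : Fin n → ℝ), inBall n ω₀ δ ω →
      lrt2 n k f x ω = 0) (ζ : Fin (n + 1) → ℝ) :
    ∃ C : ℝ, ∀ ω, inBall n ω₀ δ ω → |ζ ⬝ᵥ ld n 1 ω| ≤ 1 →
      ‖∑ i, ∑ j, (ld n 1 ω i : ℂ) * (ld n 1 ω j : ℂ) * ftrans n (f i j) ζ‖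
        ≤ C * |ζ ⬝ᵥ ld n 1 ω| ^ 3 := by
  have hfc : ∀ i j, Continuous (f i j) := fun i j => (hreg i j).1.continuous
  have hfs : ∀ i j, HasCompactSupport (f i j) := fun i j => (hreg i j).2
  refine ⟨∫ y : Fin (n + 1) → ℝ, (∑ i, ∑ j, ‖f i j y‖) * (|y 0| ^ 3 * Real.exp |y 0|), ?_⟩
  intro ω hω hτ
  set τ := ζ ⬝ᵥ ld n 1 ω with hτd
  have huc : Continuous (contr n f ω) := by unfold contr; fun_prop
  have hus : HasCompactSupport (contr n f ω) := by
    have : ∀ s : Finset (Fin (n+1) × Fin (n+1)), HasCompactSupport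
      (fun y => ∑ p ∈ s, (ld n 1 ω p.1 : ℂ) * (ld n 1 ω p.2 : ℂ) * f p.1 p.2 y) := by
      intro s
      induction s using Finset.induction_on with
      | empty => simp only [Finset.sum_empty]; exact HasCompactSupport.zero
      | insert a s ha ih =>
        simp only [Finset.sum_insert ha]
        exact ((hfs a.1 a.2).mul_left).add ih
    have h2 := this Finset.univ
    simp only [Fintype.sum_prod_type] at h2
    exact h2
  -- the phase
  let ph : (Fin (n + 1) → ℝ) → (Fin (n + 1) → ℝ) → ℂ := fun ξ y =>
    Complex.exp (-Complex.I * ((∑ i, y i * ξ i : ℝ) : ℂ))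
  have hphc : ∀ ξ, Continuous (ph ξ) := fun ξ => by fun_prop
  have hphn : ∀ ξ y, ‖ph ξ y‖ = 1 := by
    intro ξ y
    simp only [ph]
    rw [show -Complex.I * ((∑ i, y i * ξ i : ℝ) : ℂ) = ((-(∑ i, y i * ξ i) : ℝ) : ℂ) * Complex.I by
      push_cast; ring]
    exact Complex.norm_exp_ofReal_mul_I _
  let ξ : Fin (n + 1) → ℝ := ζ - τ • Pi.single 0 1
  have hξ : ξ ⬝ᵥ ld n 1 ω = 0 := by
    simp only [ξ, sub_dotProduct, smul_dotProduct, ← hτd]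
    simp [ld]
  -- G as an integral
  have hG : ∑ i, ∑ j, (ld n 1 ω i : ℂ) * (ld n 1 ω j : ℂ) * ftrans n (f i j) ζ
      = ∫ y, contr n f ω y * ph ζ y := by
    have hi : ∀ i j, Integrable (fun y => (ld n 1 ω i : ℂ) * (ld n 1 ω j : ℂ) * (f i j y * ph ζ y)) :=
      fun i j => (((hfc i j).mul (hphc ζ)).integrable_of_hasCompactSupport
        ((hfs i j).mul_right)).const_mul _
    simp only [contr, Finset.sum_mul, mul_assoc]
    simp only [mul_assoc] at hi
    rw [integral_finsetSum _ fun i _ => integrable_finsetSum _ fun j _ => hi i j]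
    refine Finset.sum_congr rfl fun i _ => ?_
    rw [integral_finsetSum _ fun j _ => hi i j]
    refine Finset.sum_congr rfl fun j _ => ?_
    rw [integral_const_mul, integral_const_mul]
    rfl
  -- moments
  have hmom : ∀ k ≤ 2, ∫ y, contr n f ω y * ((y 0 : ℂ) ^ k * ph ξ y) = 0 := by
    intro k hk
    refine fubini_line n ω _ (huc.mul (by fun_prop)) hus.mul_right ?_
    intro x
    have e1 : ∀ s : ℝ, contr n f ω (sp n x + s • ld n 1 ω) *
        (((sp n x + s • ld n 1 ω) 0 : ℝ) ^ k * ph ξ (sp n x + s • ld n 1 ω)) =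
        ph ξ (sp n x) * ((s:ℂ) ^ k * contr n f ω (sp n x + s • ld n 1 ω)) := by
      intro s
      have e2 : (sp n x + s • ld n 1 ω) 0 = s := by simp [sp, ld]
      have e3 : ph ξ (sp n x + s • ld n 1 ω) = ph ξ (sp n x) := by
        simp only [ph]
        have : (sp n x + s • ld n 1 ω) ⬝ᵥ ξ = sp n x ⬝ᵥ ξ := by
          rw [add_dotProduct, smul_dotProduct, dotProduct_comm (ld n 1 ω), hξ]; simp
        simp only [dotProduct] at this
        rw [this]
      rw [e2, e3]; ring
    simp only [e1]
    rw [integral_const_mul]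
    have e4 := h k hk (sp n x) ω hω
    have hi : ∀ i j, Integrable (fun s : ℝ => (ld n 1 ω i : ℂ) * (ld n 1 ω j : ℂ) *
        ((s:ℂ) ^ k * f i j (sp n x + s • ld n 1 ω))) := by
      intro i j
      refine Integrable.const_mul ?_ _
      have h1 := (hfs i j).comp_isClosedEmbedding (line_emb n ω (sp n x))
      have h2 := (hfc i j).comp (line_emb n ω (sp n x)).continuous
      have h3 : Continuous fun s : ℝ => (s:ℂ) ^ k := by fun_prop
      exact (h3.mul h2).integrable_of_hasCompactSupport h1.mul_left
    have e5 : ∫ s : ℝ, (s:ℂ) ^ k * contr n f ω (sp n x + s • ld n 1 ω) = lrt2 n k f (sp n x) ω := by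
      have e6 : ∀ s : ℝ, (s:ℂ) ^ k * contr n f ω (sp n x + s • ld n 1 ω) =
        ∑ i, ∑ j, (ld n 1 ω i : ℂ) * (ld n 1 ω j : ℂ) *
        ((s:ℂ) ^ k * f i j (sp n x + s • ld n 1 ω)) := by
        intro s
        simp only [contr, Finset.mul_sum]
        refine Finset.sum_congr rfl fun i _ => Finset.sum_congr rfl fun j _ => ?_
        ring
      simp only [e6, lrt2]
      rw [integral_finsetSum _ fun i _ => integrable_finsetSum _ fun j _ => hi i j]
      refine Finset.sum_congr rfl fun i _ => ?_
      rw [integral_finsetSum _ fun j _ => hi i j]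
      refine Finset.sum_congr rfl fun j _ => ?_
      rw [integral_const_mul]
    rw [e5, e4, mul_zero]
  have hmi : ∀ k, Integrable fun y => contr n f ω y * ((y 0 : ℂ) ^ k * ph ξ y) := fun k =>
    (huc.mul (by fun_prop)).integrable_of_hasCompactSupport hus.mul_right
  have hzi : Integrable fun y => contr n f ω y * ph ζ y :=
    (huc.mul (hphc ζ)).integrable_of_hasCompactSupport hus.mul_right
  let c : ℕ → ℂ := fun k => (-Complex.I * τ) ^ k / k.factorial
  have hsub : ∫ y, contr n f ω y * ph ζ y = ∫ y, (contr n f ω y * ph ζ y -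
      ∑ k ∈ Finset.range 3, c k * (contr n f ω y * ((y 0 : ℂ) ^ k * ph ξ y))) := by
    rw [integral_sub hzi (integrable_finsetSum _ fun k _ => (hmi k).const_mul _),
      integral_finsetSum _ fun k _ => (hmi k).const_mul _]
    rw [Finset.sum_eq_zero, sub_zero]
    intro k hk
    rw [integral_const_mul, hmom k (by have := Finset.mem_range.mp hk; omega), mul_zero]
  have hpt : ∀ y : Fin (n + 1) → ℝ, ‖contr n f ω y * ph ζ y -
      ∑ k ∈ Finset.range 3, c k * (contr n f ω y * ((y 0 : ℂ) ^ k * ph ξ y))‖ ≤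
      (∑ i, ∑ j, ‖f i j y‖) * (|y 0| ^ 3 * Real.exp |y 0|) * |τ| ^ 3 := by
    intro y
    have e1 : ph ζ y = ph ξ y * Complex.exp (-Complex.I * τ * y 0) := by
      simp only [ph, ← Complex.exp_add]
      congr 1
      have : y ⬝ᵥ ζ = y ⬝ᵥ ξ + τ * y 0 := by
        simp [ξ, dotProduct_sub]
      simp only [dotProduct] at this
      rw [this]; push_cast; ring
    have e2 : contr n f ω y * ph ζ y -
      ∑ k ∈ Finset.range 3, c k * (contr n f ω y * ((y 0 : ℂ) ^ k * ph ξ y)) =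
      contr n f ω y * ph ξ y * (Complex.exp (-Complex.I * τ * y 0) -
        ∑ k ∈ Finset.range 3, (-Complex.I * τ * y 0) ^ k / k.factorial) := by
      rw [e1, mul_sub, Finset.mul_sum]
      congr 1
      · ring
      · refine Finset.sum_congr rfl fun k _ => ?_
        simp only [c, mul_pow]; ring
    rw [e2, norm_mul, norm_mul, hphn, mul_one]
    have e3 := Complex.norm_exp_sub_sum_le_norm_mul_exp (-Complex.I * τ * y 0) 3
    have e4 : ‖-Complex.I * τ * y 0‖ = |τ| * |y 0| := by
      simp
    rw [e4] at e3
    have e5 : Real.exp (|τ| * |y 0|) ≤ Real.exp |y 0| :=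
      Real.exp_le_exp.mpr (mul_le_of_le_one_left (abs_nonneg _) hτ)
    calc _ ≤ (∑ i, ∑ j, ‖f i j y‖) * ((|τ| * |y 0|) ^ 3 * Real.exp |y 0|) := by
          refine mul_le_mul (contr_le n f ω hω.1 y) (e3.trans ?_) (norm_nonneg _) ?_
          · gcongr
          · exact Finset.sum_nonneg fun i _ => Finset.sum_nonneg fun j _ => norm_nonneg _
      _ = _ := by ring
  have hbi : Integrable fun y : Fin (n + 1) → ℝ =>
      (∑ i, ∑ j, ‖f i j y‖) * (|y 0| ^ 3 * Real.exp |y 0|) := by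
    simp only [Finset.sum_mul]
    refine integrable_finsetSum _ fun i _ => integrable_finsetSum _ fun j _ => ?_
    have hc := (hfc i j).norm
    refine Continuous.integrable_of_hasCompactSupport (by fun_prop) (hfs i j).norm.mul_right
  rw [hG, hsub, ← integral_mul_const]
  exact norm_integral_le_of_norm_le (hbi.mul_const _) (Filter.Eventually.of_forall hpt)

/-- The bilinear form of a complex matrix on real vectors. -/
def bil (n : ℕ) (M : Fin (n + 1) → Fin (n + 1) → ℂ) :
    (Fin (n + 1) → ℝ) →ₗ[ℝ] (Fin (n + 1) → ℝ) →ₗ[ℝ] ℂ :=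
  LinearMap.mk₂ ℝ (fun x y => ∑ i, ∑ j, (x i : ℂ) * (y j : ℂ) * M i j)
    (fun x x' y => by
      simp only [← Finset.sum_add_distrib]
      refine Finset.sum_congr rfl fun i _ => Finset.sum_congr rfl fun j _ => ?_
      simp; ring)
    (fun c x y => by
      simp only [Finset.smul_sum]
      refine Finset.sum_congr rfl fun i _ => Finset.sum_congr rfl fun j _ => ?_
      simp; ring)
    (fun x y y' => by
      simp only [← Finset.sum_add_distrib]
      refine Finset.sum_congr rfl fun i _ => Finset.sum_congr rfl fun j _ => ?_
      simp; ring)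
    (fun c x y => by
      simp only [Finset.smul_sum]
      refine Finset.sum_congr rfl fun i _ => Finset.sum_congr rfl fun j _ => ?_
      simp; ring)

lemma bil_apply (n : ℕ) (M : Fin (n + 1) → Fin (n + 1) → ℂ) (x y) :
    bil n M x y = ∑ i, ∑ j, (x i : ℂ) * (y j : ℂ) * M i j := rfl

lemma bil_single (n : ℕ) (M : Fin (n + 1) → Fin (n + 1) → ℂ) (i j) :
    bil n M (Pi.single i 1) (Pi.single j 1) = M i j := by
  rw [bil_apply, Finset.sum_eq_single i, Finset.sum_eq_single j]
  · simp
  · intro b _ hb; simp [Pi.single_apply, hb]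
  · simp
  · intro b _ hb; simp [Pi.single_apply, hb]
  · simp

lemma sp_single (n : ℕ) (p : Fin n) : sp n (Pi.single p 1) = Pi.single p.succ 1 := by
  ext i; refine Fin.cases ?_ (fun q => ?_) i
  · simp [sp]
  · simp [sp, Pi.single_apply]

/-- Let `n ≥ 3`, `c = 1`, and let `f` be a smooth compactly supported
symmetric 2-tensor field with `j_g f = −f₀₀ + Σ_{p=1}^n f_{pp} = 0`. If `L̃^{2,k} f`
vanishes for `k = 0,1,2`, all base points and all `ω ∈ B_n(ω₀, δ)`, then the Fourier
transform of `f` vanishes on `H_n`. -/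
theorem trace_free_two_tensor_fourier_vanishes_on_Hn
    (n : ℕ) (hn : 3 ≤ n)
    (ω₀ : Fin n → ℝ) (hω₀ : onSphere n ω₀) (δ : ℝ) (hδ : 0 < δ)
    (f : Fin (n + 1) → Fin (n + 1) → (Fin (n + 1) → ℝ) → ℂ)
    (hsym : ∀ i j, f i j = f j i)
    (hreg : ∀ i j, ContDiff ℝ (⊤ : ℕ∞) (f i j) ∧ HasCompactSupport (f i j))
    (htf : ∀ x, -f 0 0 x + ∑ p : Fin n, f p.succ p.succ x = 0)
    (h : ∀ k ≤ 2, ∀ (x : Fin (n + 1) → ℝ) (ω : Fin n → ℝ), inBall n ω₀ δ ω →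
      lrt2 n k f x ω = 0) :
    ∀ ζ : Fin (n + 1) → ℝ, memHn n ω₀ δ ζ → ∀ i j, ftrans n (f i j) ζ = 0 := by

  intro ζ hζ
  obtain ⟨hsp, ω, hω, horth⟩ := hζ
  set M : Fin (n + 1) → Fin (n + 1) → ℂ := fun i j => ftrans n (f i j) ζ with hM
  have hBs : ∀ x y, bil n M x y = bil n M y x := by
    intro x y
    rw [bil_apply, bil_apply, Finset.sum_comm]
    refine Finset.sum_congr rfl fun i _ => Finset.sum_congr rfl fun j _ => ?_
    simp only [hM, hsym j i]; ring
  have htr : bil n M (Pi.single 0 1) (Pi.single 0 1) =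
      ∑ p : Fin n, bil n M (sp n (Pi.single p 1)) (sp n (Pi.single p 1)) := by
    simp only [sp_single, bil_single, hM, ftrans]
    have hfc : ∀ i j, Continuous (f i j) := fun i j => (hreg i j).1.continuous
    rw [← integral_finsetSum]
    · congr 1
      ext y
      rw [← Finset.sum_mul]
      congr 1
      linear_combination -(htf y)
    · intro p _
      have := hfc p.succ p.succ
      exact Continuous.integrable_of_hasCompactSupport (by fun_prop) ((hreg _ _).2.mul_right)
  obtain ⟨C, hC⟩ := fourier_bound n ω₀ δ f hreg h ζ
  have good : ∀ ω, inBall n ω₀ δ ω → ζ ⬝ᵥ ld n 1 ω = 0 →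
      (∀ x, bil n M (ld n 1 ω) x = 0) ∧
      ∀ η, ω ⬝ᵥ η = 0 → bil n M (sp n η) (sp n η) = 0 := by
    intro ω hω hz
    have key := onept n ω₀ δ ζ (bil n M) hBs C hC ω hω hz
    have h1 : ω ⬝ᵥ ω = 1 := by
      have := hω.1
      unfold onSphere at this
      simpa [dotProduct, sq] using this
    exact trace_step n (bil n M) hBs htr ω h1 (key 0 (by simp)).1
      (fun η hη => (key η hη).2.1) (fun η hη => (key η hη).2.2)
  have hsplit : ∀ ω : Fin n → ℝ, ζ ⬝ᵥ ld n 1 ω = ζ 0 + (fun p : Fin n => ζ p.succ) ⬝ᵥ ω := by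
    intro ω
    simp [dotProduct, ld, Fin.sum_univ_succ]
  have h0 : ζ ⬝ᵥ ld n 1 ω = 0 := horth
  obtain ⟨ω', hω', e1, e2⟩ := second_pt n hn ω₀ δ (fun p => ζ p.succ) ω hω (by
    have := hsplit ω
    rw [h0] at this
    have e : (fun p : Fin n => ζ p.succ) ⬝ᵥ ω = - ζ 0 := by linarith
    rw [e, neg_sq]
    simpa [dotProduct, sq] using hsp)
  have h0' : ζ ⬝ᵥ ld n 1 ω' = 0 := by rw [hsplit, e1, ← hsplit, h0]
  have hz := twopt n (bil n M) hBs ω ω' e2 (good ω hω h0).1 (good ω' hω' h0').1 (good ω hω h0).2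
  intro i j
  have := hz (Pi.single i 1) (Pi.single j 1)
  rwa [bil_single] at this
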